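/- Let n ≥ 4, let U_n be the presented group defined below with distinguished central element z, and let λ : U_n → S_n be the homomorphism with λ(tᵢ) = (i, i+1) and λ(z) = 1. Let h ∈ S_n be any element of order 2. Then there exists a subgroup A of S_n isomorphic to the Klein four-group V_4 = ℤ/2 × ℤ/2 such that h ∈ A and z lies in the commutator subgroup [λ⁻¹(A), λ⁻¹(A)] of the preimage λ⁻¹(A) ≤ U_n. Moreover, if h lies in the alternating group A_n, then A can be chosen with A ≤ A_n. -/

import Mathlib

/-- The free-group generator `z` of Schur's presentation. -/
def zgen (n : ℕ) : FreeGroup (Unit ⊕ Fin (n - 1)) := FreeGroup.of (Sum.inl ())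

/-- The free-group generator `tᵢ` (for `i = 1, …, n-1`, zero-indexed) of Schur's
presentation. -/
def tgen (n : ℕ) (i : Fin (n - 1)) : FreeGroup (Unit ⊕ Fin (n - 1)) :=
  FreeGroup.of (Sum.inr i)

/-- The relators of Schur's presentation of a generalized representation group `Uₙ` of `Sₙ`:
`z² = 1`; `z tᵢ = tᵢ z`; `tᵢ² = z`; `(tᵢ t_{i+1})³ = z`; and `tᵢ tⱼ = z tⱼ tᵢ` for
`|i - j| ≥ 2`. -/
def schurRels (n : ℕ) : Set (FreeGroup (Unit ⊕ Fin (n - 1))) :=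
  {r | r = zgen n ^ 2
    ∨ (∃ i, r = zgen n * tgen n i * (zgen n)⁻¹ * (tgen n i)⁻¹)
    ∨ (∃ i, r = tgen n i ^ 2 * (zgen n)⁻¹)
    ∨ (∃ i j : Fin (n - 1), (i : ℕ) + 1 = (j : ℕ) ∧ r = (tgen n i * tgen n j) ^ 3 * (zgen n)⁻¹)
    ∨ (∃ i j : Fin (n - 1), ((i : ℕ) + 2 ≤ (j : ℕ) ∨ (j : ℕ) + 2 ≤ (i : ℕ)) ∧
        r = tgen n i * tgen n j * (zgen n * tgen n j * tgen n i)⁻¹)}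

/-- Schur's generalized representation group `Uₙ` of `Sₙ`, given by the presentation
`schurRels n`. -/
abbrev SchurCover (n : ℕ) := PresentedGroup (schurRels n)

/-- The distinguished central element `z` of `Uₙ`. -/
def zU (n : ℕ) : SchurCover n := PresentedGroup.of (Sum.inl ())

/-- The generator `tᵢ` of `Uₙ` (zero-indexed). -/
def tU (n : ℕ) (i : Fin (n - 1)) : SchurCover n := PresentedGroup.of (Sum.inr i)

/-- The transposition `(i, i+1)` of `Sₙ` (zero-indexed). -/
def transpo (n : ℕ) (i : Fin (n - 1)) : Equiv.Perm (Fin n) :=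
  Equiv.swap ⟨i.1, by have := i.2; omega⟩ ⟨i.1 + 1, by have := i.2; omega⟩

section Lemmas

open Equiv Equiv.Perm
open scoped commutatorElement

namespace SchurCover

variable {n : ℕ}

lemma z_mul_z : zU n * zU n = 1 := by
  have := PresentedGroup.one_of_mem (rels := schurRels n) (x := zgen n ^ 2) (Or.inl rfl)
  rwa [map_pow, pow_two] at this

lemma z_mul_t (i : Fin (n - 1)) : zU n * tU n i = tU n i * zU n := by
  have := PresentedGroup.mk_eq_mk_of_mul_inv_mem (rels := schurRels n)
    (x := zgen n * tgen n i) (y := tgen n i * zgen n)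
    (Or.inr (Or.inl ⟨i, by group⟩))
  simp only [map_mul] at this
  exact this

lemma t_mul_t (i : Fin (n - 1)) : tU n i * tU n i = zU n := by
  have := PresentedGroup.mk_eq_mk_of_mul_inv_mem (rels := schurRels n)
    (x := tgen n i ^ 2) (y := zgen n) (Or.inr (Or.inr (Or.inl ⟨i, rfl⟩)))
  rwa [map_pow, pow_two] at this

lemma t_mul_t_pow_three {i j : Fin (n - 1)} (hij : (i : ℕ) + 1 = j) :
    (tU n i * tU n j) ^ 3 = zU n := by
  have := PresentedGroup.mk_eq_mk_of_mul_inv_mem (rels := schurRels n)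
    (x := (tgen n i * tgen n j) ^ 3) (y := zgen n)
    (Or.inr (Or.inr (Or.inr (Or.inl ⟨i, j, hij, rfl⟩))))
  simp only [map_mul, map_pow] at this
  exact this

lemma t_anticomm {i j : Fin (n - 1)} (hij : (i : ℕ) + 2 ≤ j ∨ (j : ℕ) + 2 ≤ i) :
    tU n i * tU n j = zU n * tU n j * tU n i := by
  have := PresentedGroup.mk_eq_mk_of_mul_inv_mem (rels := schurRels n)
    (x := tgen n i * tgen n j) (y := zgen n * tgen n j * tgen n i)
    (Or.inr (Or.inr (Or.inr (Or.inr ⟨i, j, hij, rfl⟩))))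
  simp only [map_mul] at this
  exact this

lemma commute_z (u : SchurCover n) : Commute (zU n) u := by
  induction u using PresentedGroup.induction_on with
  | H u =>
    induction u using FreeGroup.induction_on with
    | C1 => exact map_one (PresentedGroup.mk (schurRels n)) ▸ Commute.one_right _
    | of x =>
      rcases x with ⟨⟩ | i
      · exact Commute.refl _
      · exact z_mul_t i
    | inv_of x hx => rw [map_inv]; exact hx.inv_right
    | mul x y hx hy => rw [map_mul]; exact hx.mul_right hy

lemma t_braid {i j : Fin (n - 1)} (hij : (i : ℕ) + 1 = j) :
    tU n i * tU n j * tU n i = tU n j * tU n i * tU n j := by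
  have h3 := t_mul_t_pow_three hij
  have hz := z_mul_z (n := n)
  have key : tU n i * tU n j * tU n i * (tU n j * tU n i * tU n j) =
      tU n j * tU n i * tU n j * (tU n j * tU n i * tU n j) := by
    calc _ = (tU n i * tU n j) ^ 3 := by simp only [pow_succ, pow_zero, one_mul, mul_assoc]
      _ = zU n := h3
      _ = tU n j * (zU n * zU n) * tU n j := by rw [hz, mul_one, t_mul_t]
      _ = tU n j * (tU n i * tU n i * zU n) * tU n j := by rw [t_mul_t]
      _ = tU n j * (tU n i * (zU n * tU n i)) * tU n j := by
        rw [mul_assoc (tU n i) (tU n i), z_mul_t]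
      _ = _ := by rw [← t_mul_t j]; simp only [mul_assoc]
  exact mul_right_cancel key

/-- If `j` is far from both `a` and `b`, then `tⱼ` commutes with `tₐ t_b`. -/
lemma commute_t_mul_t {j a b : Fin (n - 1)} (ha : (a : ℕ) + 2 ≤ j) (hb : (b : ℕ) + 2 ≤ j) :
    Commute (tU n j) (tU n a * tU n b) := by
  have hz := z_mul_z (n := n)
  calc tU n j * (tU n a * tU n b) = zU n * tU n a * (tU n j * tU n b) := by
        rw [← mul_assoc, t_anticomm (Or.inr ha)]; simp only [mul_assoc]
    _ = zU n * (tU n a * zU n) * (tU n b * tU n j) := by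
        rw [t_anticomm (Or.inr hb)]; simp only [mul_assoc]
    _ = (zU n * zU n) * tU n a * (tU n b * tU n j) := by
        rw [← z_mul_t]; simp only [mul_assoc]
    _ = _ := by rw [hz, one_mul, mul_assoc]

/-- The lifts `t₀ t₂` and `t₁ t₀ t₂ t₁` of two double transpositions anticommute. -/
lemma double_transposition_anticomm {a b c : Fin (n - 1)} (hab : (a : ℕ) + 1 = b)
    (hbc : (b : ℕ) + 1 = c) :
    (tU n b * tU n a * (tU n c * tU n b)) * (tU n a * tU n c) =
      zU n * ((tU n a * tU n c) * (tU n b * tU n a * (tU n c * tU n b))) := by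
  have hac := t_anticomm (i := a) (j := c) (by omega)
  have hz := z_mul_z (n := n)
  calc _ = tU n b * tU n a * tU n c * tU n b * (tU n a * tU n c) := by simp only [mul_assoc]
    _ = tU n b * tU n a * tU n c * tU n b * (zU n * (tU n c * tU n a)) := by
        rw [hac, mul_assoc (zU n)]
    _ = zU n * (tU n b * tU n a * tU n c * tU n b * (tU n c * tU n a)) := by
        rw [(commute_z _).symm.left_comm]
    _ = zU n * (tU n b * tU n a * (tU n c * tU n b * tU n c) * tU n a) := by
        simp only [mul_assoc]
    _ = zU n * ((tU n b * tU n a * tU n b) * tU n c * (tU n b * tU n a)) := by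
        rw [← t_braid hbc]; simp only [mul_assoc]
    _ = zU n * (tU n a * tU n b * (tU n a * tU n c) * (tU n b * tU n a)) := by
        rw [← t_braid hab]; simp only [mul_assoc]
    _ = zU n * (tU n a * tU n b * (zU n * (tU n c * tU n a)) * (tU n b * tU n a)) := by
        rw [hac, mul_assoc (zU n)]
    _ = (zU n * zU n) * (tU n a * tU n b * (tU n c * tU n a) * (tU n b * tU n a)) := by
        rw [(commute_z _).symm.left_comm]; simp only [mul_assoc]
    _ = tU n a * tU n b * tU n c * (tU n a * tU n b * tU n a) := by
        rw [hz, one_mul]; simp only [mul_assoc]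
    _ = tU n a * (tU n b * tU n c * tU n b) * (tU n a * tU n b) := by
        rw [t_braid hab]; simp only [mul_assoc]
    _ = tU n a * tU n c * tU n b * (tU n c * tU n a) * tU n b := by
        rw [t_braid hbc]; simp only [mul_assoc]
    _ = tU n a * tU n c * tU n b * (zU n * (tU n a * tU n c)) * tU n b := by
        rw [t_anticomm (i := c) (j := a) (by omega), mul_assoc (zU n)]
    _ = zU n * (tU n a * tU n c * tU n b * (tU n a * tU n c) * tU n b) := by
        rw [(commute_z _).symm.left_comm]; simp only [mul_assoc]
    _ = _ := by simp only [mul_assoc]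

end SchurCover

lemma isSwap_transpo {n : ℕ} (i : Fin (n - 1)) : (transpo n i).IsSwap :=
  ⟨_, _, by simp [Fin.ext_iff], rfl⟩

/-- A permutation fixing all points below `m` is a product of adjacent transpositions of points
that are at least `m`. -/
lemma mem_closure_transpo {n m : ℕ} {σ : Perm (Fin n)} (hσ : ∀ x : Fin n, (x : ℕ) < m → σ x = x) :
    σ ∈ Subgroup.closure {τ | ∃ i : Fin (n - 1), m ≤ i ∧ τ = transpo n i} := by
  set S : Set (Perm (Fin n)) := {τ | ∃ i : Fin (n - 1), m ≤ i ∧ τ = transpo n i}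
  have hS : ∀ f ∈ S, f.IsSwap := by
    rintro _ ⟨i, -, rfl⟩
    exact isSwap_transpo i
  have step : ∀ k (hk : m + k < n), (⟨m + k, hk⟩ : Fin n) ∈
      MulAction.orbit (Subgroup.closure S) (⟨m, by omega⟩ : Fin n) := by
    intro k
    induction k with
    | zero => exact fun _ ↦ MulAction.mem_orbit_self _
    | succ k ih =>
      intro hk
      have hmem : transpo n ⟨m + k, by omega⟩ ∈ Subgroup.closure S :=
        Subgroup.subset_closure ⟨_, by simp, rfl⟩
      have := MulAction.mem_orbit_of_mem_orbit (⟨_, hmem⟩ : Subgroup.closure S) (ih (by omega))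
      convert this using 1
      exact (swap_apply_left _ _).symm
  have conn (x : Fin n) (hx : m ≤ x) :
      x ∈ MulAction.orbit (Subgroup.closure S) (⟨m, by omega⟩ : Fin n) := by
    convert step (x - m) (by omega)
    omega
  refine (mem_closure_isSwap hS).2 ⟨Set.toFinite _, fun x ↦ ?_⟩
  rcases lt_or_ge (x : ℕ) m with hx | hx
  · rw [hσ x hx]
    exact MulAction.mem_orbit_self _
  · have hx' : m ≤ (σ x : ℕ) := by
      by_contra! hlt
      rw [σ.injective (hσ _ hlt)] at hlt
      omega
    rw [MulAction.orbit_eq_iff.2 (conn x hx)]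
    exact conn _ hx'

/-- Two distinct commuting involutions lie in a Klein four-group which is contained in every
subgroup containing both. -/
lemma exists_klein_four {G : Type*} [Group G] {x y : G} (hx : x * x = 1) (hy : y * y = 1)
    (hxy : Commute x y) (hx1 : x ≠ 1) (hy1 : y ≠ 1) (hne : x ≠ y) :
    ∃ A : Subgroup G, x ∈ A ∧ y ∈ A ∧ IsKleinFour A ∧
      ∀ B : Subgroup G, x ∈ B → y ∈ B → A ≤ B := by
  classical
  have h1 : x * y ≠ 1 := fun h ↦ hne (mul_right_cancel (h.trans hy.symm))
  have hyx : y * x = x * y := hxy.eq.symm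
  have c1 (w : G) : x * (x * w) = w := by rw [← mul_assoc, hx, one_mul]
  have c2 (w : G) : y * (y * w) = w := by rw [← mul_assoc, hy, one_mul]
  have c3 (w : G) : y * (x * w) = x * (y * w) := by rw [← mul_assoc, hyx, mul_assoc]
  let s : Finset G := {1, x, y, x * y}
  have hsq : ∀ a ∈ s, a * a = 1 := by
    simp only [s, Finset.mem_insert, Finset.mem_singleton]
    rintro a (rfl | rfl | rfl | rfl) <;> simp [*, mul_assoc]
  let A : Subgroup G :=
    { carrier := s
      one_mem' := by simp [s]
      mul_mem' := by
        simp only [s, Finset.coe_insert, Finset.coe_singleton, Set.mem_insert_iff,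
          Set.mem_singleton_iff]
        rintro a b (rfl | rfl | rfl | rfl) (rfl | rfl | rfl | rfl) <;> simp [*, mul_assoc]
      inv_mem' := fun {a} ha ↦ by rwa [inv_eq_of_mul_eq_one_right (hsq a ha)] }
  have memA {a : G} : a ∈ A ↔ a ∈ s := Iff.rfl
  have hcard : s.card = 4 := by
    simp only [s]
    rw [Finset.card_insert_of_notMem, Finset.card_insert_of_notMem, Finset.card_pair]
    · simpa using hx1
    · simpa [hne] using hy1
    · simp [hx1.symm, hy1.symm, h1.symm]
  refine ⟨A, by simp [memA, s], by simp [memA, s], ⟨?_, ?_⟩, fun B hxB hyB a ha ↦ ?_⟩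
  · exact (Nat.card_eq_finsetCard s).trans hcard
  · refine (Nat.dvd_prime Nat.prime_two).1 (Monoid.exponent_dvd_of_forall_pow_eq_one ?_)
      |>.resolve_left fun h ↦ hx1 ?_
    · rintro ⟨a, ha⟩
      exact Subtype.ext (by simpa [pow_two] using hsq a ha)
    · have := Monoid.pow_exponent_eq_one (⟨x, by simp [memA, s]⟩ : A)
      rw [h, pow_one] at this
      exact congrArg Subtype.val this
  · simp only [memA, s, Finset.mem_insert, Finset.mem_singleton] at ha
    rcases ha with rfl | rfl | rfl | rfl
    exacts [one_mem _, hxB, hyB, mul_mem hxB hyB]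

/-- A partner of `h`: an involution other than `h`, even if `h` is, such that some lift of it
anticommutes with some lift of `h`. -/
def HasAnticommutingPartner {n : ℕ} (lam : SchurCover n →* Perm (Fin n)) (h : Perm (Fin n)) :
    Prop :=
  ∃ u v : SchurCover n, lam u = h ∧ v * u = zU n * (u * v) ∧ lam v * lam v = 1 ∧ lam v ≠ 1 ∧
    h ≠ lam v ∧ (h ∈ alternatingGroup (Fin n) → lam v ∈ alternatingGroup (Fin n))

namespace HasAnticommutingPartner

variable {n : ℕ} {lam : SchurCover n →* Perm (Fin n)} {h : Perm (Fin n)}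

lemma conj (H : HasAnticommutingPartner lam h) (g : SchurCover n) :
    HasAnticommutingPartner lam (lam g * h * (lam g)⁻¹) := by
  obtain ⟨u, v, rfl, huv, hv2, hv1, hne, hev⟩ := H
  refine ⟨g * u * g⁻¹, g * v * g⁻¹, by simp, ?_, ?_, ?_, ?_, ?_⟩
  · calc g * v * g⁻¹ * (g * u * g⁻¹) = g * (v * u) * g⁻¹ := by group
      _ = g * (zU n * (u * v)) * g⁻¹ := by rw [huv]
      _ = zU n * (g * (u * v) * g⁻¹) := by
        rw [(SchurCover.commute_z g).symm.left_comm, mul_assoc]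
      _ = _ := by group
  · calc lam (g * v * g⁻¹) * lam (g * v * g⁻¹) = lam g * (lam v * lam v) * (lam g)⁻¹ := by
          simp only [map_mul, map_inv]; group
      _ = 1 := by rw [hv2]; group
  · simpa using hv1
  · simpa using hne
  · have hsign (w : SchurCover n) : sign (lam (g * w * g⁻¹)) = sign (lam w) := by
      simp [mul_right_comm _ _ (sign (lam g))]
    simpa only [mem_alternatingGroup, ← map_inv, ← map_mul, hsign] using hev

lemma exists_klein_four (H : HasAnticommutingPartner lam h) (hz : lam (zU n) = 1)
    (hh : orderOf h = 2) :
    ∃ A : Subgroup (Perm (Fin n)),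
      (h ∈ alternatingGroup (Fin n) → A ≤ alternatingGroup (Fin n)) ∧
      h ∈ A ∧ Nonempty (↥A ≃* Multiplicative (ZMod 2 × ZMod 2)) ∧
      zU n ∈ ⁅A.comap lam, A.comap lam⁆ := by
  obtain ⟨u, v, rfl, huv, hv2, hv1, hne, hev⟩ := H
  have hcomm : Commute (lam u) (lam v) := by
    have := congrArg lam huv
    simp only [map_mul, hz, one_mul] at this
    exact this.symm
  have hu1 : lam u ≠ 1 := by
    rintro h1
    simp [h1] at hh
  obtain ⟨A, hu, hv, hA, hle⟩ := _root_.exists_klein_four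
    (by rw [← pow_two, ← hh, pow_orderOf_eq_one]) hv2 hcomm hu1 hv1 hne
  refine ⟨A, fun he ↦ hle _ he (hev he), hu, IsKleinFour.nonempty_mulEquiv, ?_⟩
  have hzc : zU n = ⁅v, u⁆ := by
    rw [commutatorElement_def, huv]
    group
  rw [hzc]
  exact Subgroup.commutator_mem_commutator (Subgroup.mem_comap.2 hv) (Subgroup.mem_comap.2 hu)

end HasAnticommutingPartner

section

variable {n : ℕ} {lam : SchurCover n →* Perm (Fin n)}

lemma surjective_of_map_tU (ht : ∀ i, lam (tU n i) = transpo n i) : Function.Surjective lam := by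
  intro σ
  have hle : Subgroup.closure {τ | ∃ i : Fin (n - 1), 0 ≤ (i : ℕ) ∧ τ = transpo n i} ≤
      lam.range := by
    rw [Subgroup.closure_le]
    rintro _ ⟨i, -, rfl⟩
    exact ⟨_, ht i⟩
  exact hle (mem_closure_transpo (by simp))

lemma hasAnticommutingPartner_transpo (hn : 4 ≤ n) (ht : ∀ i, lam (tU n i) = transpo n i) :
    HasAnticommutingPartner lam (transpo n ⟨0, by omega⟩) := by
  refine ⟨tU n ⟨0, by omega⟩, tU n ⟨2, by omega⟩, ht _, ?_, ?_, ?_, ?_, ?_⟩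
  · rw [SchurCover.t_anticomm (by simp), mul_assoc]
  · simp [ht, transpo]
  · rw [ht]
    simp [transpo, swap_eq_one_iff]
  · rw [ht]
    intro h
    have := congrArg (fun σ : Perm (Fin n) ↦ σ ⟨0, by omega⟩) h
    simp [transpo, swap_apply_def] at this
  · simp [mem_alternatingGroup, (isSwap_transpo _).sign_eq]

lemma hasAnticommutingPartner_of_apply (hn : 4 ≤ n) (ht : ∀ i, lam (tU n i) = transpo n i)
    {h : Perm (Fin n)} (h0 : h ⟨0, by omega⟩ = ⟨1, by omega⟩)
    (h1 : h ⟨1, by omega⟩ = ⟨0, by omega⟩) (h2 : h ⟨2, by omega⟩ = ⟨3, by omega⟩)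
    (h3 : h ⟨3, by omega⟩ = ⟨2, by omega⟩) :
    HasAnticommutingPartner lam h := by
  let a : Fin (n - 1) := ⟨0, by omega⟩
  let b : Fin (n - 1) := ⟨1, by omega⟩
  let c : Fin (n - 1) := ⟨2, by omega⟩
  let p := tU n a * tU n c
  let q := tU n b * tU n a * (tU n c * tU n b)
  have hfix (x : Fin n) (hx : (x : ℕ) < 4) : ((lam p)⁻¹ * h) x = x := by
    rw [Perm.mul_apply, Perm.inv_eq_iff_eq]
    obtain ⟨x, hxn⟩ := x
    simp only at hx
    interval_cases x <;> simp [p, a, c, ht, transpo, swap_apply_def, h0, h1, h2, h3]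
  have hle : Subgroup.closure {τ | ∃ i : Fin (n - 1), 4 ≤ (i : ℕ) ∧ τ = transpo n i} ≤
      (Subgroup.centralizer {p, q}).map lam := by
    rw [Subgroup.closure_le]
    rintro _ ⟨i, hi, rfl⟩
    refine ⟨tU n i, ?_, ht i⟩
    rw [SetLike.mem_coe, Subgroup.mem_centralizer_iff]
    rintro _ (rfl | rfl)
    · exact (SchurCover.commute_t_mul_t (by simp [a]; omega) (by simp [c]; omega)).symm.eq
    · exact ((SchurCover.commute_t_mul_t (by simp [b]; omega) (by simp [a]; omega)).mul_right
        (SchurCover.commute_t_mul_t (by simp [c]; omega) (by simp [b]; omega))).symm.eq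
  obtain ⟨w, hw, hwr⟩ := hle (mem_closure_transpo hfix)
  have hqw : q * w = w * q := Subgroup.mem_centralizer_iff.1 hw q (by simp)
  have hq0 : lam q ⟨0, by omega⟩ = ⟨2, by omega⟩ := by
    simp [q, a, b, c, ht, transpo, swap_apply_def]
  refine ⟨p * w, q, by simp [hwr], ?_, ?_, fun hq ↦ ?_, fun hq ↦ ?_, fun _ ↦ ?_⟩
  · have hqp : q * p = zU n * (p * q) := SchurCover.double_transposition_anticomm rfl rfl
    rw [← mul_assoc, hqp, mul_assoc p w, ← hqw]
    simp only [mul_assoc]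
  · have hac : transpo n a * transpo n c = transpo n c * transpo n a := by
      refine Equiv.Perm.Disjoint.commute (fun x ↦ ?_)
      simp only [transpo, a, c, swap_apply_def, Fin.ext_iff]
      split_ifs <;> simp_all
    have sq (i : Fin (n - 1)) : transpo n i * transpo n i = 1 := swap_mul_self _ _
    calc lam q * lam q = transpo n b * (transpo n a * transpo n c) *
          (transpo n b * transpo n b) * (transpo n a * transpo n c) * transpo n b := by
          simp only [q, map_mul, ht, mul_assoc]
      _ = transpo n b * (transpo n a * ((transpo n c * transpo n c) * transpo n a)) *
          transpo n b := by
          rw [sq b, mul_one, mul_assoc (transpo n b), mul_assoc (transpo n a) (transpo n c)]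
          rw [hac]
          simp only [mul_assoc]
      _ = 1 := by rw [sq c, one_mul, sq a, mul_one, sq b]
  · rw [hq] at hq0
    simp at hq0
  · rw [← hq, h0] at hq0
    simp at hq0
  · simp [q, mem_alternatingGroup, ht, (isSwap_transpo _).sign_eq]

lemma hasAnticommutingPartner_of_orderOf_eq_two (hn : 4 ≤ n)
    (ht : ∀ i, lam (tU n i) = transpo n i) {h : Perm (Fin n)} (hh : orderOf h = 2) :
    HasAnticommutingPartner lam h := by
  have hinv (x : Fin n) : h (h x) = x := by
    rw [← Perm.mul_apply, ← pow_two, ← hh, pow_orderOf_eq_one, Perm.one_apply]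
  have hne : h ≠ 1 := by
    rintro rfl
    simp at hh
  obtain ⟨x, hx⟩ : ∃ x, h x ≠ x := by
    by_contra! hfix
    exact hne (Equiv.ext hfix)
  by_cases hsw : ∃ y, h y ≠ y ∧ y ≠ x ∧ y ≠ h x
  · obtain ⟨y, hy, hyx, hyhx⟩ := hsw
    have hhy : h y ≠ x := fun e ↦ hyhx (by rw [← e, hinv])
    let f : Fin 4 ↪ Fin n := ⟨![x, h x, y, h y], by
      intro i j
      fin_cases i <;> fin_cases j <;> simp [hx, hy, hyx, hyhx, hhy, hx.symm, hy.symm, hyx.symm,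
        hyhx.symm, hhy.symm]⟩
    have := Equiv.Perm.isMultiplyPretransitive (Fin n) 4
    obtain ⟨g, hg⟩ := MulAction.exists_smul_eq (Perm (Fin n)) (Fin.castLEEmb hn) f
    have hgi (i : Fin 4) : g (Fin.castLE hn i) = f i := congrArg (fun e : Fin 4 ↪ Fin n ↦ e i) hg
    have g0 : g ⟨0, by omega⟩ = x := hgi 0
    have g1 : g ⟨1, by omega⟩ = h x := hgi 1
    have g2 : g ⟨2, by omega⟩ = y := hgi 2
    have g3 : g ⟨3, by omega⟩ = h y := hgi 3
    have H : HasAnticommutingPartner lam (g⁻¹ * h * g) := by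
      apply hasAnticommutingPartner_of_apply hn ht <;>
        simp [Equiv.symm_apply_eq, g0, g1, g2, g3, hinv]
    obtain ⟨k, rfl⟩ := surjective_of_map_tU ht g
    convert H.conj k using 1
    group
  · push Not at hsw
    have hswap : h = swap x (h x) := by
      ext1 y
      rw [swap_apply_def]
      split_ifs with h1 h2
      · rw [h1]
      · rw [h2, hinv]
      · by_contra h3
        exact h2 (hsw y h3 h1)
    have hconj : IsConj (transpo n ⟨0, by omega⟩) h := by
      rw [hswap]
      exact isConj_swap (by simp [Fin.ext_iff]) hx.symm
    obtain ⟨g, hg⟩ := isConj_iff.1 hconj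
    obtain ⟨k, rfl⟩ := surjective_of_map_tU ht g
    exact hg ▸ (hasAnticommutingPartner_transpo hn ht).conj k

end

end Lemmas

/-- Let `n ≥ 4`, let `λ : Uₙ → Sₙ` be the homomorphism with
`λ(tᵢ) = (i, i+1)` and `λ(z) = 1`, and let `h ∈ Sₙ` have order 2. Then there is a subgroup
`A ≤ Sₙ` isomorphic to the Klein four-group `V₄ = ℤ/2 × ℤ/2` with `h ∈ A` and
`z ∈ [λ⁻¹(A), λ⁻¹(A)]`; moreover, if `h ∈ Aₙ` then `A` can be chosen with `A ≤ Aₙ`. -/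
theorem exists_klein_four_with_z_in_commutator (n : ℕ) (hn : 4 ≤ n)
    (lam : SchurCover n →* Equiv.Perm (Fin n))
    (hz : lam (zU n) = 1)
    (ht : ∀ i : Fin (n - 1), lam (tU n i) = transpo n i)
    (h : Equiv.Perm (Fin n)) (hh : orderOf h = 2) :
    (∃ A : Subgroup (Equiv.Perm (Fin n)),
      h ∈ A ∧ Nonempty (↥A ≃* Multiplicative (ZMod 2 × ZMod 2)) ∧
      zU n ∈ ⁅A.comap lam, A.comap lam⁆) ∧
    (h ∈ alternatingGroup (Fin n) →
      ∃ A : Subgroup (Equiv.Perm (Fin n)),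
        A ≤ alternatingGroup (Fin n) ∧
        h ∈ A ∧ Nonempty (↥A ≃* Multiplicative (ZMod 2 × ZMod 2)) ∧
        zU n ∈ ⁅A.comap lam, A.comap lam⁆) := by
  obtain ⟨A, hA, H⟩ :=
    (hasAnticommutingPartner_of_orderOf_eq_two hn ht hh).exists_klein_four hz hh
  exact ⟨⟨A, H⟩, fun he ↦ ⟨A, hA he, H⟩⟩
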